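/- Let k ≥ 0, ℓ ≥ 1 and λ ∈ P_ℓ^k. If x ∈ [1, bot_λ − 1] and λ_x > λ_{x+1}, then Δ^k(λ) has a ceiling in columns down_λ(x), down_λ(x)+1: both columns lie in [ℓ] and the columns down_λ(x) and down_λ(x)+1 of Δ^k(λ) have the same number of elements, i.e. #{i : (i, down_λ(x)) ∈ Δ^k(λ)} = #{i : (i, down_λ(x)+1) ∈ Δ^k(λ)}. -/

import Mathlib

open scoped Classical

noncomputable section

/-- The ambient ring: formal power series over ℚ in countably many variables. -/
abbrev R : Type := MvPowerSeries ℕ ℚ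

/-- The complete homogeneous symmetric function `h_m` (equal to `0` for `m < 0`):
its coefficient at a monomial is `1` if the monomial has total degree `m`, else `0`. -/
def hh (m : ℤ) : R := fun d => if ((d.sum fun _ e => (e : ℤ)) = m) then 1 else 0

/-- The inhomogeneous analogue `k_m^{(r)} = ∑_{i=0}^{m} C(r+i−1, i) · h_{m−i}`. -/
def kk (r : ℕ) (m : ℤ) : R :=
  ∑ i ∈ Finset.range (m.toNat + 1), ((r + i - 1).choose i : ℚ) • hh (m - (i : ℤ))

/-- The dual stable Grothendieck polynomial `g_γ`, as an `ℓ × ℓ` determinant with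
`(i,j)` entry `k_{γ_i + j − i}^{(i−1)}` (indices 1-based). -/
def gg (ℓ : ℕ) (γ : ℕ → ℤ) : R :=
  (Matrix.of fun i j : Fin ℓ =>
    kk i.val (γ (i.val + 1) + (j.val : ℤ) - (i.val : ℤ))).det

/-- The `i`-th standard basis vector `ε_i`. -/
def eps (i : ℕ) : ℕ → ℤ := fun x => if x = i then 1 else 0

/-- The Katalan function `K(Ψ; M; γ)`. -/
def katalan (ℓ : ℕ) (Ψ : Finset (ℕ × ℕ)) (M : Multiset ℕ) (γ : ℕ → ℤ) : R :=
  (M.powerset.map fun S =>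
    (-1 : R) ^ Multiset.card S *
      ∑ᶠ α : {p // p ∈ Ψ} → ℕ,
        gg ℓ (fun x =>
          γ x + (∑ p ∈ Ψ.attach, (α p : ℤ) * (eps p.1.1 x - eps p.1.2 x))
            - (S.map fun z => eps z x).sum)).sum

/-- The set of positive roots `Δ_ℓ^+ = {(i,j) : 1 ≤ i < j ≤ ℓ}`. -/
def DeltaPlus (ℓ : ℕ) : Finset (ℕ × ℕ) :=
  (Finset.Icc 1 ℓ ×ˢ Finset.Icc 1 ℓ).filter fun p => p.1 < p.2

/-- A root ideal: an upper order ideal of `Δ_ℓ^+`. -/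
def IsRootIdeal (ℓ : ℕ) (Ψ : Finset (ℕ × ℕ)) : Prop :=
  Ψ ⊆ DeltaPlus ℓ ∧
    ∀ a b c d : ℕ, (a, b) ∈ Ψ → (c, d) ∈ DeltaPlus ℓ → c ≤ a → b ≤ d → (c, d) ∈ Ψ

/-- The root ideal `Δ^k(λ) = {(i,j) ∈ Δ_ℓ^+ : j > k − λ_i + i}`. -/
def DeltaK (k ℓ : ℕ) (lam : ℕ → ℤ) : Finset (ℕ × ℕ) :=
  (DeltaPlus ℓ).filter fun p => (k : ℤ) - lam p.1 + (p.1 : ℤ) < (p.2 : ℤ)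

/-- `bot(Ψ)`: the largest `x` such that row `x` of `Ψ` is nonempty (`0` if `Ψ = ∅`). -/
def botIdeal (Ψ : Finset (ℕ × ℕ)) : ℕ := Ψ.sup Prod.fst

/-- `bot_λ := bot(Δ^k(λ))`. -/
def botL (k ℓ : ℕ) (lam : ℕ → ℤ) : ℕ := botIdeal (DeltaK k ℓ lam)

/-- A removable root of a root ideal. -/
def IsRemovable (ℓ : ℕ) (Ψ : Finset (ℕ × ℕ)) (α : ℕ × ℕ) : Prop :=
  α ∈ Ψ ∧ IsRootIdeal ℓ (Ψ.erase α)

/-- `down_Ψ(x)` is defined, i.e. row `x` of `Ψ` contains a removable root. -/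
def HasDown (ℓ : ℕ) (Ψ : Finset (ℕ × ℕ)) (x : ℕ) : Prop :=
  ∃ j, IsRemovable ℓ Ψ (x, j)

/-- `down_Ψ(x)`: the column of the removable root in row `x` (junk value `0` if
row `x` has no removable root). -/
def down (ℓ : ℕ) (Ψ : Finset (ℕ × ℕ)) (x : ℕ) : ℕ :=
  ((Ψ.filter fun p => p.1 = x ∧ IsRemovable ℓ Ψ p).image Prod.snd).sup id

/-- `down_λ := down_{Δ^k(λ)}`. -/
def downL (k ℓ : ℕ) (lam : ℕ → ℤ) : ℕ → ℕ := down ℓ (DeltaK k ℓ lam)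

/-- The `a`-fold iterate `down_Ψ^a(x)` is defined. -/
def DownIterDefined (ℓ : ℕ) (Ψ : Finset (ℕ × ℕ)) (a x : ℕ) : Prop :=
  ∀ b < a, HasDown ℓ Ψ ((down ℓ Ψ)^[b] x)

/-- `L(ℛ)`: the multiset of second components of `ℛ`, with multiplicity. -/
def Lmul (ℛ : Finset (ℕ × ℕ)) : Multiset ℕ := ℛ.val.map Prod.snd

/-- `λ ∈ P_ℓ^k`: a `k`-bounded partition with `ℓ` parts allowed to be zero. -/
def IsKBounded (k ℓ : ℕ) (lam : ℕ → ℤ) : Prop :=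
  lam 1 ≤ (k : ℤ) ∧ (∀ i, 1 ≤ i → i < ℓ → lam (i + 1) ≤ lam i) ∧ 0 ≤ lam ℓ

/-- The multiset `M_z(λ)`: `L(Δ^k(λ))` with one occurrence of `down_λ(x)` removed
for each `x ∈ [z, bot_λ]`. -/
def Mz (k ℓ : ℕ) (lam : ℕ → ℤ) (z : ℕ) : Multiset ℕ :=
  Lmul (DeltaK k ℓ lam) - ((Finset.Icc z (botL k ℓ lam)).val.map (downL k ℓ lam))

/-- The `K`-`k`-Schur function of weight `z`: `ĝ_λ^{(z)} = K(Δ^k(λ); M_z(λ); λ)`. -/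
def wkschur (k ℓ : ℕ) (lam : ℕ → ℤ) (z : ℕ) : R :=
  katalan ℓ (DeltaK k ℓ lam) (Mz k ℓ lam z) lam

/-- The `K`-`k`-Schur function `g_λ^{(k)} = K(Δ^k(λ); L(Δ^{k+1}(λ)); λ)`. -/
def kkschur (k ℓ : ℕ) (lam : ℕ → ℤ) : R :=
  katalan ℓ (DeltaK k ℓ lam) (Lmul (DeltaK (k + 1) ℓ lam)) lam

/-- The closed `k`-Schur Katalan function `𝔤_λ^{(k)} = K(Δ^k(λ); L(Δ^k(λ)); λ)`. -/
def closedkschur (k ℓ : ℕ) (lam : ℕ → ℤ) : R :=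
  katalan ℓ (DeltaK k ℓ lam) (Lmul (DeltaK k ℓ lam)) lam

/-- `|λ| = λ_1 + ⋯ + λ_ℓ`. -/
def psize (ℓ : ℕ) (lam : ℕ → ℤ) : ℤ := ∑ i ∈ Finset.Icc 1 ℓ, lam i

theorem mem_DeltaK {k ℓ : ℕ} {lam : ℕ → ℤ} {i j : ℕ} :
    (i, j) ∈ DeltaK k ℓ lam ↔
      1 ≤ i ∧ i < j ∧ j ≤ ℓ ∧ (k : ℤ) - lam i + (i : ℤ) < (j : ℤ) := by
  simp only [DeltaK, DeltaPlus, Finset.mem_filter, Finset.mem_product, Finset.mem_Icc]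
  omega

theorem IsKBounded.antitone {k ℓ : ℕ} {lam : ℕ → ℤ} (hlam : IsKBounded k ℓ lam)
    {i j : ℕ} (hi : 1 ≤ i) (hij : i ≤ j) (hj : j ≤ ℓ) : lam j ≤ lam i := by
  induction j, hij using Nat.le_induction with
  | base => exact le_rfl
  | succ n hn ih => exact (hlam.2.1 n (by omega) (by omega)).trans (ih (by omega))

/-- The leftmost root of row `x` is the only candidate for a removable root of `Δ^k(λ)` in that
row, and it is removable. -/
theorem isRemovable_DeltaK_iff {k ℓ : ℕ} {lam : ℕ → ℤ} (hlam : IsKBounded k ℓ lam)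
    {x d : ℕ} (hd : (d : ℤ) = k - lam x + x + 1) (hmem : (x, d) ∈ DeltaK k ℓ lam) (j : ℕ) :
    IsRemovable ℓ (DeltaK k ℓ lam) (x, j) ↔ j = d := by
  constructor
  · rintro ⟨hj, -, hup⟩
    by_contra hne
    have hle : d ≤ j := by have := mem_DeltaK.1 hj; omega
    refine Finset.notMem_erase (x, j) (DeltaK k ℓ lam)
      (hup x d x j (Finset.mem_erase.2 ⟨?_, hmem⟩) (Finset.mem_filter.1 hj).1 le_rfl hle)
    simpa using Ne.symm hne
  · rintro rfl
    refine ⟨hmem, fun p hp => (Finset.mem_filter.1 (Finset.mem_erase.1 hp).2).1, ?_⟩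
    intro a b c e hab hce hca hbe
    obtain ⟨hne, hab⟩ := Finset.mem_erase.1 hab
    have hab' := mem_DeltaK.1 hab
    have hce' : 1 ≤ c ∧ c < e ∧ e ≤ ℓ := by
      simp only [DeltaPlus, Finset.mem_filter, Finset.mem_product, Finset.mem_Icc] at hce
      omega
    have hanti := hlam.antitone hce'.1 hca (by omega)
    refine Finset.mem_erase.2 ⟨fun h => hne ?_, mem_DeltaK.2 (by omega)⟩
    obtain ⟨rfl, rfl⟩ := Prod.mk.inj h
    obtain rfl : a = c := by omega
    obtain rfl : b = e := by omega
    rfl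

theorem down_eq_of_isRemovable_iff {ℓ : ℕ} {Ψ : Finset (ℕ × ℕ)} {x d : ℕ}
    (h : ∀ j, IsRemovable ℓ Ψ (x, j) ↔ j = d) : down ℓ Ψ x = d := by
  have hfilter : (Ψ.filter fun p => p.1 = x ∧ IsRemovable ℓ Ψ p) = {(x, d)} := by
    ext ⟨a, b⟩
    simp only [Finset.mem_filter, Finset.mem_singleton, Prod.mk.injEq]
    constructor
    · rintro ⟨-, rfl, hr⟩
      exact ⟨rfl, (h b).1 hr⟩
    · rintro ⟨rfl, rfl⟩
      have hr := (h b).2 rfl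
      exact ⟨hr.1, rfl, hr⟩
  simp [down, hfilter]

/-- The rows up to `bot_λ` of `Δ^k(λ)` are nonempty. -/
theorem lt_of_le_botL {k ℓ : ℕ} {lam : ℕ → ℤ} (hlam : IsKBounded k ℓ lam)
    {y : ℕ} (hy : 1 ≤ y) (hbot : y ≤ botL k ℓ lam) :
    y < ℓ ∧ (k : ℤ) - lam y + (y : ℤ) < (ℓ : ℤ) := by
  obtain ⟨⟨b, j⟩, hmem, hle⟩ := (Finset.le_sup_iff (show ⊥ < y from hy)).1 hbot
  have hb := mem_DeltaK.1 hmem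
  have hyb : y ≤ b := hle
  have hanti := hlam.antitone hy hyb (by omega)
  omega

/-- A column of `Δ^k(λ)` in which exactly the first `x` rows have a root contains `x` roots. -/
theorem card_column_DeltaK {k ℓ : ℕ} {lam : ℕ → ℤ} {x c : ℕ}
    (h : ∀ i, (i, c) ∈ DeltaK k ℓ lam ↔ 1 ≤ i ∧ i ≤ x) :
    ((DeltaK k ℓ lam).filter fun p => p.2 = c).card = x := by
  have himage : ((DeltaK k ℓ lam).filter fun p => p.2 = c) =
      (Finset.Icc 1 x).image fun i => (i, c) := by
    ext ⟨a, b⟩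
    simp only [Finset.mem_filter, Finset.mem_image, Finset.mem_Icc, Prod.mk.injEq]
    constructor
    · rintro ⟨hm, rfl⟩
      exact ⟨a, (h a).1 hm, rfl, rfl⟩
    · rintro ⟨i, hi, rfl, rfl⟩
      exact ⟨(h i).2 hi, rfl⟩
  rw [himage, Finset.card_image_of_injective _ fun _ _ hij => (Prod.mk.inj hij).1]
  simp

/-- if `x ∈ [bot_λ − 1]` and `λ_x > λ_{x+1}`, then `Δ^k(λ)` has a
ceiling in columns `down_λ(x), down_λ(x) + 1`. -/
theorem statement14 (k ℓ : ℕ) (hℓ : 1 ≤ ℓ) (lam : ℕ → ℤ) (hlam : IsKBounded k ℓ lam)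
    (x : ℕ) (hx : x ∈ Finset.Icc 1 (botL k ℓ lam - 1))
    (hstrict : lam (x + 1) < lam x) :
    downL k ℓ lam x ∈ Finset.Icc 1 ℓ ∧
    downL k ℓ lam x + 1 ∈ Finset.Icc 1 ℓ ∧
    ((DeltaK k ℓ lam).filter fun p => p.2 = downL k ℓ lam x).card =
      ((DeltaK k ℓ lam).filter fun p => p.2 = downL k ℓ lam x + 1).card := by
  obtain ⟨hx1, hxb⟩ := Finset.mem_Icc.1 hx
  obtain ⟨hxl, hlast⟩ := lt_of_le_botL hlam (y := x + 1) (by omega) (by omega)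
  have hk : lam x ≤ k := (hlam.antitone le_rfl hx1 (by omega)).trans hlam.1
  obtain ⟨d, hd⟩ : ∃ d : ℕ, (d : ℤ) = k - lam x + x + 1 :=
    ⟨(k - lam x + x + 1).toNat, Int.toNat_of_nonneg (by omega)⟩
  push_cast at hlast
  have hdown : downL k ℓ lam x = d := down_eq_of_isRemovable_iff
    (isRemovable_DeltaK_iff hlam hd (mem_DeltaK.2 (by omega)))
  have hcol : ∀ c, d ≤ c → c ≤ d + 1 → ∀ i, (i, c) ∈ DeltaK k ℓ lam ↔ 1 ≤ i ∧ i ≤ x := by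
    intro c hc hc' i
    rw [mem_DeltaK]
    constructor
    · rintro ⟨hi, hic, hcl, hlt⟩
      refine ⟨hi, ?_⟩
      by_contra hxi
      have := hlam.antitone (i := x + 1) (j := i) (by omega) (by omega) (by omega)
      omega
    · rintro ⟨hi, hix⟩
      have := hlam.antitone hi hix (by omega)
      omega
  rw [hdown, Finset.mem_Icc, Finset.mem_Icc]
  refine ⟨by omega, by omega, ?_⟩
  rw [card_column_DeltaK (hcol d le_rfl (by omega)),
    card_column_DeltaK (hcol (d + 1) (by omega) le_rfl)]

end
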